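/- arXiv:2412.15996 — 2 statements merged into one kernel-verified Lean document; each statement's English description precedes it below -/
import Mathlib

section
/- Let n ≥ 1 and consider the action of the orthochronous Poincaré group G on ℝ × ℝ^n given by (Λ,T)·(u,y) = ( u − η(T, P̃(φ_Λ(y))), φ_Λ(y) ). Then for every (u,y), the stabilizer of (u,y) equals { (Λ,T) ∈ G : ΛP̃(y) = P̃(y) and η(T, P̃(y)) = 0 }. In particular, the stabilizer of the point (0, 0) (whose hyperboloid point is P̃(0) = e₀ = (1,0,…,0)) equals { (Λ,T) : Λe₀ = e₀ and T⁰ = 0 }, and the map sending such (Λ,T) to the pair (lower-right n×n block of Λ, (T¹,…,Tⁿ)) is a group isomorphism onto the semidirect product O(n) ⋉ ℝ^n (with O(n) acting on ℝ^n in the standard way). Hence Ti is the homogeneous space (SO(n,1) ⋉ ℝ^{n+1}) / (SO(n) ⋉ ℝ^n) fibred over H^n. -/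
open scoped BigOperators
open Filter MeasureTheory
open scoped Matrix

noncomputable section

/-- Minkowski inner product on `ℝ^{1,n}` (mostly plus signature). -/
def minkowski (n : ℕ) (X Y : Fin (n+1) → ℝ) : ℝ :=
  -(X 0 * Y 0) + ∑ i : Fin n, X i.succ * Y i.succ

/-- Parametrization of the future unit hyperboloid `H^n ⊂ ℝ^{1,n}`. -/
def hyp (n : ℕ) (y : Fin n → ℝ) : Fin (n+1) → ℝ :=
  Fin.cons (Real.sqrt (1 + ∑ i, y i ^ 2)) y

/-- The Minkowski metric as a matrix, `η = diag(-1, 1, …, 1)`. -/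
def etaMat (n : ℕ) : Matrix (Fin (n+1)) (Fin (n+1)) ℝ :=
  Matrix.diagonal (fun i => if i = 0 then (-1 : ℝ) else 1)

/-- An orthochronous Lorentz transformation: `Λᵀ η Λ = η` and `Λ⁰⁰ > 0`. -/
def IsOrthochronousLorentz (n : ℕ) (Λ : Matrix (Fin (n+1)) (Fin (n+1)) ℝ) : Prop :=
  Λᵀ * etaMat n * Λ = etaMat n ∧ 0 < Λ 0 0

/-- The map `φ_Λ` induced by a Lorentz transformation on the hyperboloid chart. -/
def lorentzBdy (n : ℕ) (Λ : Matrix (Fin (n+1)) (Fin (n+1)) ℝ) (y : Fin n → ℝ) : Fin n → ℝ :=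
  fun i => Λ.mulVec (hyp n y) i.succ

/-- The Poincaré action on `Ti ≅ ℝ × ℝⁿ`. -/
def poincAct (n : ℕ) (Λ : Matrix (Fin (n+1)) (Fin (n+1)) ℝ) (T : Fin (n+1) → ℝ)
    (p : ℝ × (Fin n → ℝ)) : ℝ × (Fin n → ℝ) :=
  (p.1 - minkowski n T (hyp n (lorentzBdy n Λ p.2)), lorentzBdy n Λ p.2)

/-- The first basis vector `e₀ = (1,0,…,0) = P̃(0)`. -/
def e0 (n : ℕ) : Fin (n+1) → ℝ := fun i => if i = 0 then 1 else 0

/-- The lower-right `n × n` block of an `(n+1) × (n+1)` matrix. -/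
def spatialBlock (n : ℕ) (Λ : Matrix (Fin (n+1)) (Fin (n+1)) ℝ) : Matrix (Fin n) (Fin n) ℝ :=
  fun i j => Λ i.succ j.succ

/-- The spatial part `(T¹,…,Tⁿ)` of a vector in `ℝ^{1,n}`. -/
def spatialVec (n : ℕ) (T : Fin (n+1) → ℝ) : Fin n → ℝ := fun i => T i.succ

/-- The stabilizer of the point `(0,0) ∈ Ti` inside the orthochronous Poincaré group. -/
def TiStab (n : ℕ) : Set (Matrix (Fin (n+1)) (Fin (n+1)) ℝ × (Fin (n+1) → ℝ)) :=
  {p | IsOrthochronousLorentz n p.1 ∧ p.1.mulVec (e0 n) = e0 n ∧ p.2 0 = 0}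

theorem minkowski_eq_dotProduct (n : ℕ) (X Y : Fin (n+1) → ℝ) :
    minkowski n X Y = X ⬝ᵥ (etaMat n).mulVec Y := by
  simp [minkowski, etaMat, dotProduct, Matrix.mulVec_diagonal, Fin.sum_univ_succ]

theorem transpose_mul_etaMat_mul_apply (n : ℕ) (Λ : Matrix (Fin (n+1)) (Fin (n+1)) ℝ)
    (i j : Fin (n+1)) :
    (Λᵀ * etaMat n * Λ) i j = minkowski n (fun k => Λ k i) (fun k => Λ k j) := by
  rw [Matrix.mul_apply]
  simp [minkowski, etaMat, Matrix.mul_diagonal, Fin.sum_univ_succ]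

theorem etaMat_mul_self (n : ℕ) : etaMat n * etaMat n = 1 := by
  rw [etaMat, Matrix.diagonal_mul_diagonal, ← Matrix.diagonal_one]
  congr 1
  ext i
  split_ifs <;> norm_num

namespace IsOrthochronousLorentz

variable {n : ℕ} {Λ : Matrix (Fin (n+1)) (Fin (n+1)) ℝ}

theorem minkowski_mulVec (h : IsOrthochronousLorentz n Λ) (X Y : Fin (n+1) → ℝ) :
    minkowski n (Λ.mulVec X) (Λ.mulVec Y) = minkowski n X Y := by
  rw [minkowski_eq_dotProduct, minkowski_eq_dotProduct]
  conv_rhs => rw [← h.1, ← Matrix.mulVec_mulVec, ← Matrix.mulVec_mulVec,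
    Matrix.dotProduct_mulVec X, Matrix.vecMul_transpose]

theorem mul_etaMat_mul_transpose (h : IsOrthochronousLorentz n Λ) :
    Λ * etaMat n * Λᵀ = etaMat n := by
  have h1 : etaMat n * Λᵀ * etaMat n * Λ = 1 := by
    rw [← etaMat_mul_self, Matrix.mul_assoc (etaMat n), Matrix.mul_assoc (etaMat n), h.1]
  have h2 := mul_eq_one_comm.mp h1
  calc Λ * etaMat n * Λᵀ = Λ * (etaMat n * Λᵀ * etaMat n) * etaMat n := by
        simp only [Matrix.mul_assoc, etaMat_mul_self, Matrix.mul_one]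
    _ = etaMat n := by rw [h2, Matrix.one_mul]

theorem sum_sq_zero_row (h : IsOrthochronousLorentz n Λ) :
    ∑ i : Fin n, Λ 0 i.succ ^ 2 = Λ 0 0 ^ 2 - 1 := by
  have h1 := transpose_mul_etaMat_mul_apply n Λᵀ 0 0
  rw [Matrix.transpose_transpose, h.mul_etaMat_mul_transpose] at h1
  simp only [etaMat, minkowski, Matrix.diagonal_apply_eq, if_true, Matrix.transpose_apply,
    ← pow_two] at h1
  linarith

theorem mulVec_hyp_zero_pos (h : IsOrthochronousLorentz n Λ) (y : Fin n → ℝ) :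
    0 < Λ.mulVec (hyp n y) 0 := by
  have hy : 0 ≤ ∑ i, y i ^ 2 := Finset.sum_nonneg fun i _ => sq_nonneg _
  have hcs := Finset.sum_mul_sq_le_sq_mul_sq Finset.univ (fun i : Fin n => Λ 0 i.succ) y
  rw [h.sum_sq_zero_row] at hcs
  have hs : 0 < Λ 0 0 * √(1 + ∑ i, y i ^ 2) := mul_pos h.2 (Real.sqrt_pos.mpr (by linarith))
  have hlt : (∑ i : Fin n, Λ 0 i.succ * y i) ^ 2 < (Λ 0 0 * √(1 + ∑ i, y i ^ 2)) ^ 2 := by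
    rw [mul_pow, Real.sq_sqrt (by linarith)]
    nlinarith [pow_pos h.2 2]
  have := (abs_lt.mp (abs_lt_of_sq_lt_sq hlt hs.le)).1
  simp only [Matrix.mulVec, dotProduct, hyp, Fin.sum_univ_succ, Fin.cons_zero, Fin.cons_succ]
  linarith

theorem hyp_lorentzBdy (h : IsOrthochronousLorentz n Λ) (y : Fin n → ℝ) :
    hyp n (lorentzBdy n Λ y) = Λ.mulVec (hyp n y) := by
  have hy : 0 ≤ ∑ i, y i ^ 2 := Finset.sum_nonneg fun i _ => sq_nonneg _
  have hm := h.minkowski_mulVec (hyp n y) (hyp n y)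
  have hh : minkowski n (hyp n y) (hyp n y) = -1 := by
    simp only [minkowski, hyp, Fin.cons_zero, Fin.cons_succ, ← pow_two]
    rw [Real.sq_sqrt (by linarith)]
    ring
  rw [hh] at hm
  simp only [minkowski, ← pow_two] at hm
  ext i
  refine Fin.cases ?_ (fun j => ?_) i
  · change √(1 + ∑ i : Fin n, Λ.mulVec (hyp n y) i.succ ^ 2) = Λ.mulVec (hyp n y) 0
    rw [← Real.sqrt_sq (h.mulVec_hyp_zero_pos y).le]
    congr 1
    linarith
  · simp [hyp, lorentzBdy]

end IsOrthochronousLorentz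

theorem hyp_injective (n : ℕ) : Function.Injective (hyp n) := fun _ _ h =>
  (Fin.cons_injective2 h).2

theorem hyp_zero (n : ℕ) : hyp n (fun _ => 0) = e0 n := by
  ext i
  refine Fin.cases ?_ (fun j => ?_) i <;> simp [hyp, e0]

theorem minkowski_e0 (n : ℕ) (T : Fin (n+1) → ℝ) : minkowski n T (e0 n) = -T 0 := by
  simp [minkowski, e0]

theorem mulVec_e0 (n : ℕ) (Λ : Matrix (Fin (n+1)) (Fin (n+1)) ℝ) (i : Fin (n+1)) :
    Λ.mulVec (e0 n) i = Λ i 0 := by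
  simp [Matrix.mulVec, dotProduct, e0]

theorem poincAct_eq_self_iff {n : ℕ} {Λ : Matrix (Fin (n+1)) (Fin (n+1)) ℝ}
    (h : IsOrthochronousLorentz n Λ) (T : Fin (n+1) → ℝ) (u : ℝ) (y : Fin n → ℝ) :
    poincAct n Λ T (u, y) = (u, y) ↔
      Λ.mulVec (hyp n y) = hyp n y ∧ minkowski n T (hyp n y) = 0 := by
  rw [poincAct, Prod.mk.injEq, ← h.hyp_lorentzBdy, (hyp_injective n).eq_iff, and_comm]
  refine and_congr_right fun hy => ?_
  rw [hy, sub_eq_self]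

theorem mem_TiStab_iff {n : ℕ}
    {p : Matrix (Fin (n+1)) (Fin (n+1)) ℝ × (Fin (n+1) → ℝ)} :
    p ∈ TiStab n ↔ p.1 0 0 = 1 ∧ (∀ i : Fin n, p.1 i.succ 0 = 0) ∧
      (∀ i : Fin n, p.1 0 i.succ = 0) ∧ (spatialBlock n p.1)ᵀ * spatialBlock n p.1 = 1 ∧
      p.2 0 = 0 := by
  obtain ⟨Λ, T⟩ := p
  simp only [TiStab, Set.mem_ofPred_eq, IsOrthochronousLorentz, ← Matrix.ext_iff,
    transpose_mul_etaMat_mul_apply, funext_iff, mulVec_e0]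
  simp only [Fin.forall_fin_succ, minkowski, etaMat, e0, Matrix.mul_apply, spatialBlock, Matrix.transpose_apply, Matrix.diagonal_apply,
    Matrix.one_apply, Fin.succ_inj, Fin.succ_ne_zero, (Fin.succ_ne_zero _).symm, if_true, if_false]
  constructor
  · rintro ⟨⟨⟨⟨_, h0⟩, hB⟩, -⟩, ⟨h00, hc⟩, hT⟩
    have hr : ∀ i : Fin n, Λ 0 i.succ = 0 := fun i => by simpa [h00, hc] using h0 i
    exact ⟨h00, hc, hr, fun i j => by simpa [hr] using (hB i).2 j, hT⟩
  · rintro ⟨h00, hc, hr, hB, hT⟩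
    simp [h00, hc, hr, hB, hT]

theorem spatialBlock_mul {n : ℕ} {Λ : Matrix (Fin (n+1)) (Fin (n+1)) ℝ}
    (h : ∀ i : Fin n, Λ i.succ 0 = 0) (M : Matrix (Fin (n+1)) (Fin (n+1)) ℝ) :
    spatialBlock n (Λ * M) = spatialBlock n Λ * spatialBlock n M := by
  ext i j
  simp [spatialBlock, Matrix.mul_apply, Fin.sum_univ_succ, h]

theorem spatialVec_add_mulVec {n : ℕ} {Λ : Matrix (Fin (n+1)) (Fin (n+1)) ℝ}
    (h : ∀ i : Fin n, Λ i.succ 0 = 0) (S T : Fin (n+1) → ℝ) :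
    spatialVec n (S + Λ.mulVec T)
      = spatialVec n S + (spatialBlock n Λ).mulVec (spatialVec n T) := by
  ext i
  simp [spatialBlock, spatialVec, Matrix.mulVec, dotProduct, Fin.sum_univ_succ, h]

theorem TiStab_mul_mem {n : ℕ}
    {p q : Matrix (Fin (n+1)) (Fin (n+1)) ℝ × (Fin (n+1) → ℝ)}
    (hp : p ∈ TiStab n) (hq : q ∈ TiStab n) :
    (p.1 * q.1, p.2 + p.1.mulVec q.2) ∈ TiStab n := by
  rw [mem_TiStab_iff] at hp hq ⊢
  obtain ⟨p00, pc, pr, pB, pT⟩ := hp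
  obtain ⟨q00, qc, qr, qB, qT⟩ := hq
  refine ⟨?_, fun i => ?_, fun i => ?_, ?_, ?_⟩
  · simp [Matrix.mul_apply, Fin.sum_univ_succ, p00, q00, pr]
  · simp [Matrix.mul_apply, Fin.sum_univ_succ, pc, qc]
  · simp [Matrix.mul_apply, Fin.sum_univ_succ, pr, qr]
  · rw [spatialBlock_mul pc, Matrix.transpose_mul, Matrix.mul_assoc,
      ← Matrix.mul_assoc (spatialBlock n p.1)ᵀ, pB, Matrix.one_mul, qB]
  · simp [Matrix.mulVec, dotProduct, Fin.sum_univ_succ, pr, pT, qT]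

theorem TiStab_ext {n : ℕ} {p q : Matrix (Fin (n+1)) (Fin (n+1)) ℝ × (Fin (n+1) → ℝ)}
    (hp : p ∈ TiStab n) (hq : q ∈ TiStab n) (hB : spatialBlock n p.1 = spatialBlock n q.1)
    (ht : spatialVec n p.2 = spatialVec n q.2) : p = q := by
  obtain ⟨p00, pc, pr, -, pT⟩ := mem_TiStab_iff.mp hp
  obtain ⟨q00, qc, qr, -, qT⟩ := mem_TiStab_iff.mp hq
  refine Prod.ext (Matrix.ext fun i j => ?_) (funext fun i => ?_)
  · refine Fin.cases ?_ (fun i => ?_) i <;> refine Fin.cases ?_ (fun j => ?_) j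
    · rw [p00, q00]
    · rw [pr, qr]
    · rw [pc, qc]
    · exact congrFun (congrFun hB i) j
  · refine Fin.cases ?_ (fun i => ?_) i
    · rw [pT, qT]
    · exact congrFun ht i

theorem exists_mem_TiStab {n : ℕ} {B : Matrix (Fin n) (Fin n) ℝ} (hB : Bᵀ * B = 1)
    (t : Fin n → ℝ) : ∃ p ∈ TiStab n, spatialBlock n p.1 = B ∧ spatialVec n p.2 = t := by
  let Λ : Matrix (Fin (n+1)) (Fin (n+1)) ℝ :=
    Matrix.of (Fin.cons (Fin.cons 1 0) fun i => Fin.cons 0 (B i))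
  have hΛ : spatialBlock n Λ = B := by
    ext i j
    simp [spatialBlock, Λ]
  refine ⟨(Λ, Fin.cons 0 t), mem_TiStab_iff.mpr ⟨?_, fun i => ?_, fun i => ?_, ?_, ?_⟩, hΛ, ?_⟩
  · simp [Λ]
  · simp [Λ]
  · simp [Λ]
  · rw [hΛ, hB]
  · simp
  · ext i
    simp [spatialVec]

/-- The stabilizer of a point `(u,y) ∈ Ti` under the Poincaré action is
`{(Λ,T) : ΛP̃(y) = P̃(y), η(T,P̃(y)) = 0}`; for the point `(0,0)` this is
`{(Λ,T) : Λe₀ = e₀, T⁰ = 0}`, and `(Λ,T) ↦ (lower-right block of Λ, spatial part of T)`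
is a group isomorphism of the latter onto `O(n) ⋉ ℝⁿ`. -/
theorem ti_stabilizer_is_euclidean_group (n : ℕ) (hn : 1 ≤ n) :
    (∀ (u : ℝ) (y : Fin n → ℝ) (Λ : Matrix (Fin (n+1)) (Fin (n+1)) ℝ) (T : Fin (n+1) → ℝ),
      IsOrthochronousLorentz n Λ →
        (poincAct n Λ T (u, y) = (u, y) ↔
          (Λ.mulVec (hyp n y) = hyp n y ∧ minkowski n T (hyp n y) = 0))) ∧
    (∀ (Λ : Matrix (Fin (n+1)) (Fin (n+1)) ℝ) (T : Fin (n+1) → ℝ),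
      IsOrthochronousLorentz n Λ →
        (poincAct n Λ T (0, fun _ => 0) = (0, fun _ => 0) ↔
          (Λ.mulVec (e0 n) = e0 n ∧ T 0 = 0))) ∧
    (∀ p ∈ TiStab n, (spatialBlock n p.1)ᵀ * spatialBlock n p.1 = 1) ∧
    (∀ p ∈ TiStab n, ∀ q ∈ TiStab n,
      spatialBlock n p.1 = spatialBlock n q.1 → spatialVec n p.2 = spatialVec n q.2 →
        p = q) ∧
    (∀ B : Matrix (Fin n) (Fin n) ℝ, Bᵀ * B = 1 → ∀ t : Fin n → ℝ,
      ∃ p ∈ TiStab n, spatialBlock n p.1 = B ∧ spatialVec n p.2 = t) ∧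
    (∀ p ∈ TiStab n, ∀ q ∈ TiStab n,
      (p.1 * q.1, p.2 + p.1.mulVec q.2) ∈ TiStab n ∧
      spatialBlock n (p.1 * q.1) = spatialBlock n p.1 * spatialBlock n q.1 ∧
      spatialVec n (p.2 + p.1.mulVec q.2)
        = spatialVec n p.2 + (spatialBlock n p.1).mulVec (spatialVec n q.2)) := by
  refine ⟨fun u y Λ T h => poincAct_eq_self_iff h T u y, fun Λ T h => ?_,
    fun p hp => (mem_TiStab_iff.mp hp).2.2.2.1, fun p hp q hq => TiStab_ext hp hq,
    fun B hB t => exists_mem_TiStab hB t, fun p hp q hq => ?_⟩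
  · rw [poincAct_eq_self_iff h, hyp_zero, minkowski_e0, neg_eq_zero]
  · have hc := (mem_TiStab_iff.mp hp).2.1
    exact ⟨TiStab_mul_mem hp hq, spatialBlock_mul hc q.1, spatialVec_add_mulVec hc p.2 q.2⟩
end
end

section
/- Let n ≥ 1 and let h_{αβ} : ℝ^n → ℝ^{n×n} be a smooth family of invertible symmetric matrices. On ℝ × ℝ^n with coordinates (x⁰, x¹,…,xⁿ) = (u, y), let h_{ab} be the degenerate metric with h_{uu} = h_{uα} = 0, h_{αβ} = h_{αβ}(y), and let n^a = ∂_u. Let Γ^a_{bc} be a smooth family of connection coefficients symmetric in (b,c). Then the two conditions (i) ∇_c n^a = 0, i.e. Γ^a_{cu} = 0 for all a, c, and (ii) ∇_c h_{ab} = 0, i.e. ∂_c h_{ab} = Σ_d ( Γ^d_{ca} h_{db} + Γ^d_{cb} h_{ad} ) for all a, b, c, hold if and only if: Γ^α_{βγ}(u,y) equals the Levi-Civita Christoffel symbols ½ h^{αδ}(∂_β h_{δγ} + ∂_γ h_{δβ} − ∂_δ h_{βγ}) of h_{αβ}, all components Γ^a_{bc} with any index equal to u vanish except possibly Γ^u_{βγ},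 and Γ^u_{βγ} is an arbitrary smooth symmetric family (unconstrained by (i) and (ii)). In particular, two torsion-free connections compatible with (n^a, h_{ab}) differ exactly by a tensor of the form C_{bc} n^a with C symmetric and n^b C_{bc} = 0. -/
open scoped BigOperators
open Filter MeasureTheory

noncomputable section

/-- Partial derivative in the `i`-th coordinate direction. -/
def pdv {m : ℕ} {F : Type*} [NormedAddCommGroup F] [NormedSpace ℝ F]
    (i : Fin m) (f : (Fin m → ℝ) → F) (x : Fin m → ℝ) : F :=
  fderiv ℝ f x (Pi.single i 1)

/-- Extension of a spatial 2-tensor on `ℝⁿ` by zero to adapted coordinates on `ℝ × ℝⁿ`. -/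
def spatialExt (n : ℕ) (T : Fin n → Fin n → ℝ) (b c : Fin (n+1)) : ℝ :=
  Fin.cases (motive := fun _ => ℝ) 0
    (fun β => Fin.cases (motive := fun _ => ℝ) 0 (fun γ => T β γ) c) b

/-- The degenerate Carrollian metric `h_{ab}` on `ℝ × ℝⁿ`. -/
def degH (n : ℕ) (hmat : (Fin n → ℝ) → Fin n → Fin n → ℝ)
    (x : Fin (n+1) → ℝ) (a b : Fin (n+1)) : ℝ :=
  spatialExt n (hmat (x ∘ Fin.succ)) a b

/-- Christoffel symbols `Γ^γ_{αβ}` of a metric `h_{αβ}` on `ℝⁿ` (via the matrix inverse). -/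
def ChrG (n : ℕ) (hmat : (Fin n → ℝ) → Fin n → Fin n → ℝ)
    (y : Fin n → ℝ) (γ α β : Fin n) : ℝ :=
  (1/2) * ∑ δ, (Matrix.of (hmat y))⁻¹ γ δ *
    (pdv α (fun y => hmat y δ β) y + pdv β (fun y => hmat y δ α) y
      - pdv δ (fun y => hmat y α β) y)

/-- The compatibility conditions `∇_c n^a = 0` (i.e. `Γ^a_{cu} = 0`) and `∇_c h_{ab} = 0`
for connection coefficients on `ℝ × ℝⁿ`. -/
def CompatibleCarroll (n : ℕ) (hmat : (Fin n → ℝ) → Fin n → Fin n → ℝ)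
    (Γ : (Fin (n+1) → ℝ) → Fin (n+1) → Fin (n+1) → Fin (n+1) → ℝ) : Prop :=
  (∀ (x : Fin (n+1) → ℝ) (a c : Fin (n+1)), Γ x a c 0 = 0) ∧
  (∀ (x : Fin (n+1) → ℝ) (a b c : Fin (n+1)),
    pdv c (fun x => degH n hmat x a b) x
      = (∑ d, Γ x d c a * degH n hmat x d b) + (∑ d, Γ x d c b * degH n hmat x a d))

theorem degH_zero_left {n : ℕ} (hmat : (Fin n → ℝ) → Fin n → Fin n → ℝ)
    (x : Fin (n+1) → ℝ) (b : Fin (n+1)) : degH n hmat x 0 b = 0 := rfl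

theorem degH_zero_right {n : ℕ} (hmat : (Fin n → ℝ) → Fin n → Fin n → ℝ)
    (x : Fin (n+1) → ℝ) (a : Fin (n+1)) : degH n hmat x a 0 = 0 := by
  cases a using Fin.cases <;> rfl

theorem degH_succ_succ {n : ℕ} (hmat : (Fin n → ℝ) → Fin n → Fin n → ℝ)
    (x : Fin (n+1) → ℝ) (α β : Fin n) :
    degH n hmat x α.succ β.succ = hmat (x ∘ Fin.succ) α β := rfl

theorem pdv_const {m : ℕ} (i : Fin m) (r : ℝ) (x : Fin m → ℝ) :
    pdv i (fun _ => r) x = 0 := by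
  simp [pdv]

/-- Derivative of a function of the spatial coordinates only. -/
theorem pdv_comp_succ {n : ℕ} {f : (Fin n → ℝ) → ℝ} (hf : Differentiable ℝ f)
    (x : Fin (n+1) → ℝ) (c : Fin (n+1)) :
    pdv c (fun x => f (x ∘ Fin.succ)) x
      = fderiv ℝ f (x ∘ Fin.succ) ((Pi.single c (1 : ℝ) : Fin (n+1) → ℝ) ∘ Fin.succ) := by
  let L : (Fin (n+1) → ℝ) →L[ℝ] (Fin n → ℝ) :=
    ContinuousLinearMap.pi fun i => ContinuousLinearMap.proj i.succ
  have h := (hf (L x)).hasFDerivAt.comp x L.hasFDerivAt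
  exact congrArg (fun T => T (Pi.single c (1 : ℝ))) h.fderiv

theorem pdv_zero_comp_succ {n : ℕ} {f : (Fin n → ℝ) → ℝ} (hf : Differentiable ℝ f)
    (x : Fin (n+1) → ℝ) : pdv 0 (fun x => f (x ∘ Fin.succ)) x = 0 := by
  have h : (Pi.single 0 (1 : ℝ) : Fin (n+1) → ℝ) ∘ Fin.succ = 0 := by
    funext i
    simp
  rw [pdv_comp_succ hf, h, map_zero]

theorem pdv_succ_comp_succ {n : ℕ} {f : (Fin n → ℝ) → ℝ} (hf : Differentiable ℝ f)
    (x : Fin (n+1) → ℝ) (γ : Fin n) :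
    pdv γ.succ (fun x => f (x ∘ Fin.succ)) x = pdv γ f (x ∘ Fin.succ) := by
  have h : (Pi.single γ.succ (1 : ℝ) : Fin (n+1) → ℝ) ∘ Fin.succ = Pi.single γ 1 := by
    funext i
    simp [Pi.single_apply]
  rw [pdv_comp_succ hf, h, pdv]

/-- The Koszul argument at a point: a symmetric `G` satisfies metric compatibility with first
derivatives `D c a b = ∂_c h_{ab}` iff it is given by the Christoffel formula. -/
theorem metric_compatible_iff_christoffel {ι : Type*} [Fintype ι] [DecidableEq ι]
    (H : Matrix ι ι ℝ) (hH : IsUnit H.det) (hHs : ∀ a b, H a b = H b a)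
    (D G : ι → ι → ι → ℝ) (hD : ∀ c a b, D c a b = D c b a)
    (hG : ∀ a b c, G a b c = G a c b) :
    (∀ a b c, D c a b = (∑ d, G d c a * H d b) + ∑ d, G d c b * H a d) ↔
      ∀ a b c, G a b c = (1/2) * ∑ d, H⁻¹ a d * (D b d c + D c d b - D d b c) := by
  have lower : (∀ a b c, G a b c = (1/2) * ∑ d, H⁻¹ a d * (D b d c + D c d b - D d b c)) ↔
      ∀ e b c, ∑ d, H e d * G d b c = (1/2) * (D b e c + D c e b - D e b c) := by
    have key (b c : ι) :
        (fun a => G a b c) = H⁻¹.mulVec (fun d => (1/2) * (D b d c + D c d b - D d b c)) ↔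
        H.mulVec (fun a => G a b c) = fun d => (1/2) * (D b d c + D c d b - D d b c) := by
      constructor
      · intro h
        rw [h, Matrix.mulVec_mulVec, Matrix.mul_nonsing_inv H hH, Matrix.one_mulVec]
      · intro h
        rw [← h, Matrix.mulVec_mulVec, Matrix.nonsing_inv_mul H hH, Matrix.one_mulVec]
    simp only [funext_iff, Matrix.mulVec, dotProduct, mul_left_comm _ (1/2 : ℝ),
      ← Finset.mul_sum] at key
    exact ⟨fun h e b c => (key b c).1 (fun a => h a b c) e,
      fun h a b c => (key b c).2 (fun e => h e b c) a⟩
  have left (a b c : ι) : ∑ d, G d c a * H d b = ∑ d, H b d * G d c a :=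
    Finset.sum_congr rfl fun d _ => by rw [hHs d b, mul_comm]
  have right (a b c : ι) : ∑ d, G d c b * H a d = ∑ d, H a d * G d c b :=
    Finset.sum_congr rfl fun d _ => mul_comm _ _
  have swap (a b c : ι) : ∑ d, H a d * G d b c = ∑ d, H a d * G d c b :=
    Finset.sum_congr rfl fun d _ => by rw [hG]
  rw [lower]
  simp only [left, right]
  constructor
  · intro h e b c
    linarith [h e c b, h e b c, h b c e, swap e b c, swap b c e, swap c b e]
  · intro h a b c
    linarith [h b c a, h a c b, hD c a b, hD a b c, hD b a c]

theorem compatibleCarroll_iff {n : ℕ} {hmat : (Fin n → ℝ) → Fin n → Fin n → ℝ}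
    (hdiff : ∀ α β, Differentiable ℝ fun y => hmat y α β)
    (hsym : ∀ (y : Fin n → ℝ) (α β : Fin n), hmat y α β = hmat y β α)
    (hinvert : ∀ y : Fin n → ℝ, IsUnit (Matrix.of (hmat y)).det)
    {Γ : (Fin (n+1) → ℝ) → Fin (n+1) → Fin (n+1) → Fin (n+1) → ℝ}
    (hΓ : ∀ x a b c, Γ x a b c = Γ x a c b) :
    CompatibleCarroll n hmat Γ ↔
      ((∀ (x : Fin (n+1) → ℝ) (α β γ : Fin n),
          Γ x α.succ β.succ γ.succ = ChrG n hmat (x ∘ Fin.succ) α β γ) ∧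
       (∀ (x : Fin (n+1) → ℝ) (a b : Fin (n+1)), Γ x a b 0 = 0) ∧
       (∀ (x : Fin (n+1) → ℝ) (a b : Fin (n+1)), Γ x a 0 b = 0)) := by
  have koszul (x : Fin (n+1) → ℝ) := metric_compatible_iff_christoffel
    (Matrix.of (hmat (x ∘ Fin.succ))) (hinvert _) (hsym _)
    (fun c a b => pdv c (fun y => hmat y a b) (x ∘ Fin.succ))
    (fun a b c => Γ x a.succ b.succ c.succ)
    (fun c a b => by simp only [hsym _ a b]) (fun a b c => hΓ x _ _ _)
  constructor
  · rintro ⟨h0, h⟩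
    refine ⟨fun x => (koszul x).1 fun a b c => ?_, h0, fun x a b => by rw [hΓ, h0]⟩
    have := h x a.succ b.succ c.succ
    simp only [degH_succ_succ, degH_zero_left, degH_zero_right, Fin.sum_univ_succ, mul_zero,
      zero_add] at this
    rw [pdv_succ_comp_succ (hdiff a b)] at this
    exact this
  · rintro ⟨h, h0, h0'⟩
    refine ⟨h0, fun x a b c => ?_⟩
    cases a using Fin.cases with
    | zero => simp [degH_zero_left, pdv_const, h0]
    | succ a =>
      cases b using Fin.cases with
      | zero => simp [degH_zero_right, pdv_const, h0]
      | succ b =>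
        simp only [degH_succ_succ]
        cases c using Fin.cases with
        | zero => simp [pdv_zero_comp_succ (hdiff a b), h0']
        | succ c =>
          rw [pdv_succ_comp_succ (hdiff a b)]
          simp only [degH_succ_succ, degH_zero_left, degH_zero_right, Fin.sum_univ_succ, mul_zero,
            zero_add]
          exact (koszul x).2 (h x) a b c

/-- Characterization of the torsion-free connections compatible with the Carrollian
structure `(∂_u, h_{αβ}(y)dy^αdy^β)`: the spatial components are the Levi-Civita
Christoffel symbols of `h`, all components with a `u` index vanish except `Γ^u_{βγ}`
which is unconstrained; in particular two compatible torsion-free connections differ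
exactly by a tensor `C_{bc}n^a` with `C` symmetric and `n^bC_{bc} = 0`. -/
theorem carroll_connection_characterization
    (n : ℕ) (hn : 1 ≤ n)
    (hmat : (Fin n → ℝ) → Fin n → Fin n → ℝ)
    (hsm : ContDiff ℝ (⊤ : ℕ∞) hmat)
    (hsym : ∀ (y : Fin n → ℝ) (α β : Fin n), hmat y α β = hmat y β α)
    (hinvert : ∀ y : Fin n → ℝ, IsUnit (Matrix.of (hmat y)).det) :
    (∀ Γ : (Fin (n+1) → ℝ) → Fin (n+1) → Fin (n+1) → Fin (n+1) → ℝ,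
      ContDiff ℝ (⊤ : ℕ∞) Γ → (∀ x a b c, Γ x a b c = Γ x a c b) →
        (CompatibleCarroll n hmat Γ ↔
          ((∀ (x : Fin (n+1) → ℝ) (α β γ : Fin n),
              Γ x α.succ β.succ γ.succ = ChrG n hmat (x ∘ Fin.succ) α β γ) ∧
           (∀ (x : Fin (n+1) → ℝ) (a b : Fin (n+1)), Γ x a b 0 = 0) ∧
           (∀ (x : Fin (n+1) → ℝ) (a b : Fin (n+1)), Γ x a 0 b = 0)))) ∧
    (∀ Γ₁ Γ₂ : (Fin (n+1) → ℝ) → Fin (n+1) → Fin (n+1) → Fin (n+1) → ℝ,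
      ContDiff ℝ (⊤ : ℕ∞) Γ₁ → (∀ x a b c, Γ₁ x a b c = Γ₁ x a c b) → CompatibleCarroll n hmat Γ₁ →
      ContDiff ℝ (⊤ : ℕ∞) Γ₂ → (∀ x a b c, Γ₂ x a b c = Γ₂ x a c b) → CompatibleCarroll n hmat Γ₂ →
        ∃ C : (Fin (n+1) → ℝ) → Fin (n+1) → Fin (n+1) → ℝ,
          (∀ (x : Fin (n+1) → ℝ) (b c : Fin (n+1)), C x b c = C x c b) ∧
          (∀ (x : Fin (n+1) → ℝ) (c : Fin (n+1)), C x 0 c = 0) ∧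
          (∀ (x : Fin (n+1) → ℝ) (a b c : Fin (n+1)),
            Γ₁ x a b c - Γ₂ x a b c = (if a = 0 then C x b c else 0))) := by
  have hdiff (α β : Fin n) : Differentiable ℝ fun y => hmat y α β := by
    have h := hsm.differentiable (by simp)
    fun_prop
  refine ⟨fun Γ _ hΓ => compatibleCarroll_iff hdiff hsym hinvert hΓ, ?_⟩
  intro Γ₁ Γ₂ _ hΓ₁ hc₁ _ hΓ₂ hc₂
  obtain ⟨hs₁, hr₁, hl₁⟩ := (compatibleCarroll_iff hdiff hsym hinvert hΓ₁).1 hc₁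
  obtain ⟨hs₂, hr₂, hl₂⟩ := (compatibleCarroll_iff hdiff hsym hinvert hΓ₂).1 hc₂
  refine ⟨fun x b c => Γ₁ x 0 b c - Γ₂ x 0 b c, fun x b c => by simp only [hΓ₁ x 0 b c, hΓ₂ x 0 b c],
    fun x c => by simp only [hl₁, hl₂, sub_zero], fun x a b c => ?_⟩
  cases a using Fin.cases with
  | zero => simp
  | succ a =>
    rw [if_neg (Fin.succ_ne_zero a)]
    cases b using Fin.cases with
    | zero => rw [hl₁, hl₂, sub_zero]
    | succ b =>
      cases c using Fin.cases with
      | zero => rw [hr₁, hr₂, sub_zero]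
      | succ c => rw [hs₁, hs₂, sub_self]
end
end
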